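/- For every (T,φ) ∈ OP_Γ, the normal cone to the face F(T,φ) of the Voronoi polytope, namely {α ∈ H₁(Γ,ℝ) : (α,r) ≥ (α,r') for all r ∈ F(T,φ) and all r' ∈ Vor_Γ}, equals the cone σ(T,φ); hence the cographic fan coincides with the normal fan of the Voronoi polytope Vor_Γ. -/

import Mathlib

/-!
Serre-style finite graphs: a vertex type `V`, an oriented-edge type `E` with a
fixed-point-free involution `inv` (edge reversal) and source/target maps `s, t`
with `s (inv e) = t e`.  An unoriented edge is an `inv`-orbit `{e, inv e}`;
subsets of unoriented edges are encoded as `inv`-closed subsets of `E`, and an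
orientation of a spanning subgraph `Γ∖T` is encoded by the set `O` of its
positively oriented edges.  1-chains with coefficients in `A` are encoded as
functions `c : E → A` with `c (inv e) = - c e` (so that `(c, e⃗) = c e` for the
standard bilinear form).
-/

structure SerreGraph where
  V : Type
  E : Type
  [fintypeV : Fintype V]
  [fintypeE : Fintype E]
  [decEqV : DecidableEq V]
  [decEqE : DecidableEq E]
  inv : E → E
  s : E → V
  t : E → V
  inv_inv : ∀ e, inv (inv e) = e
  inv_ne : ∀ e, inv e ≠ e
  s_inv : ∀ e, s (inv e) = t e

attribute [instance] SerreGraph.fintypeV SerreGraph.fintypeE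
attribute [instance] SerreGraph.decEqV SerreGraph.decEqE

namespace SerreGraph

variable (Γ : SerreGraph)

/-- Reachability between vertices in the spanning subgraph whose allowed oriented
edges are those in `A`. -/
def Reach (A : Set Γ.E) : Γ.V → Γ.V → Prop :=
  Relation.ReflTransGen (fun a b => ∃ e ∈ A, Γ.s e = a ∧ Γ.t e = b)

/-- The number of connected components of the spanning subgraph with allowed
oriented edges `A`. -/
noncomputable def numComponents (A : Set Γ.E) : ℕ :=
  Nat.card (Quot (fun a b : Γ.V => ∃ e ∈ A, Γ.s e = a ∧ Γ.t e = b))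

/-- The set of separating (oriented) edges: removing the underlying unoriented
edge increases the number of connected components. -/
def Esep : Set Γ.E :=
  {e | Γ.numComponents Set.univ < Γ.numComponents {f | f ≠ e ∧ f ≠ Γ.inv e}}

/-- `T` encodes a set of unoriented edges. -/
def InvClosed (T : Set Γ.E) : Prop := ∀ e, e ∈ T ↔ Γ.inv e ∈ T

/-- `O` is (the set of positively oriented edges of) an orientation of `Γ∖T`. -/
def IsOrientation (T O : Set Γ.E) : Prop :=
  (∀ e ∈ O, e ∉ T) ∧ ∀ e, e ∉ T → (e ∈ O ↔ Γ.inv e ∉ O)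

/-- A totally cyclic orientation of `Γ∖T`: an orientation such that there is no
vertex set `W` which is nonempty and proper inside some connected component of
`Γ∖T` and such that all edges of `Γ∖T` crossing the boundary of `W` are oriented
out of `W` (this is the componentwise condition of the paper). -/
def IsTotallyCyclic (T O : Set Γ.E) : Prop :=
  Γ.IsOrientation T O ∧
    ¬ ∃ W : Set Γ.V, (∃ v ∈ W, ∃ w ∈ Wᶜ, Γ.Reach Tᶜ v w) ∧
        ∀ e ∈ O, Γ.t e ∈ W → Γ.s e ∈ W

/-- `γ` is (the set of positively oriented edges of) an oriented circuit of `Γ`: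
a cyclic subgraph (connected, first Betti number one, no separating edges)
together with a totally cyclic orientation; equivalently a directed cycle:
each incident vertex has exactly one outgoing and one incoming edge in `γ`,
and the support is connected. -/
def IsCircuit (γ : Finset Γ.E) : Prop :=
  γ.Nonempty ∧ (∀ e ∈ γ, Γ.inv e ∉ γ) ∧
    (∀ v ∈ γ.image Γ.s ∪ γ.image Γ.t, ∃! e, e ∈ γ ∧ Γ.s e = v) ∧
    (∀ v ∈ γ.image Γ.s ∪ γ.image Γ.t, ∃! e, e ∈ γ ∧ Γ.t e = v) ∧
    ∀ e ∈ γ, ∀ f ∈ γ, Γ.Reach ((↑γ : Set Γ.E) ∪ Γ.inv '' ↑γ) (Γ.s e) (Γ.s f)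

/-- The class `[γ] ∈ H₁(Γ,ℤ)` of an oriented circuit. -/
def circChainZ (γ : Finset Γ.E) : Γ.E → ℤ :=
  fun e => if e ∈ γ then 1 else if Γ.inv e ∈ γ then -1 else 0

/-- The class `[γ] ∈ H₁(Γ,ℝ)` of an oriented circuit. -/
noncomputable def circChainR (γ : Finset Γ.E) : Γ.E → ℝ :=
  fun e => (Γ.circChainZ γ e : ℝ)

/-- `Cir_φ(Γ∖T)`: oriented circuits of `Γ∖T` compatibly oriented with the
orientation with positive edges `O`. -/
def Cir (T O : Set Γ.E) : Set (Finset Γ.E) :=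
  {γ | Γ.IsCircuit γ ∧ (∀ e ∈ γ, e ∈ O) ∧ ∀ e ∈ γ, e ∉ T}

/-- `c` is a 1-cycle: a skew 1-chain with vanishing boundary, i.e. an element of
`H₁(Γ,A)`. -/
def IsCycle {A : Type*} [AddCommGroup A] (c : Γ.E → A) : Prop :=
  (∀ e, c (Γ.inv e) = - c e) ∧
    ∀ v, ∑ e ∈ Finset.univ.filter (fun e => Γ.t e = v), c e = 0

/-- An element of `H₁(Γ∖T, A) ⊆ H₁(Γ,A)`: a cycle supported on edges not in `T`. -/
def IsCycleOn {A : Type*} [AddCommGroup A] (T : Set Γ.E) (c : Γ.E → A) : Prop :=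
  Γ.IsCycle c ∧ ∀ e ∈ T, c e = 0

/-- The standard positive definite bilinear form on `C⃗₁(Γ,ℝ)`, for which
`(c, e⃗) = c e`. -/
noncomputable def pair (c c' : Γ.E → ℝ) : ℝ := (∑ e, c e * c' e) / 2

/-- The first Betti number `b₁(Γ) = dim_ℝ H₁(Γ,ℝ)`. -/
noncomputable def b1 : ℕ :=
  Module.finrank ℝ (Submodule.span ℝ {c : Γ.E → ℝ | Γ.IsCycle c})

/-- `b₁(Γ∖T) = dim_ℝ H₁(Γ∖T,ℝ)`. -/
noncomputable def b1Sub (T : Set Γ.E) : ℕ :=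
  Module.finrank ℝ (Submodule.span ℝ {c : Γ.E → ℝ | Γ.IsCycleOn T c})

/-- The cone `σ(T,φ) ⊆ H₁(Γ,ℝ)` of the cographic fan associated to a pair
`(T, O)` with `O` an orientation of `Γ∖T`. -/
def sigmaCone (T O : Set Γ.E) : Set (Γ.E → ℝ) :=
  {v | Γ.IsCycle v ∧ (∀ e ∈ O, 0 ≤ v e) ∧ ∀ e ∈ T, v e = 0}

/-- The poset `OP_Γ` of totally cyclic orientations: pairs `(T, O)` with `T` a
set of unoriented edges and `O` a totally cyclic orientation of `Γ∖T`. -/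
def OP : Set (Set Γ.E × Set Γ.E) :=
  {p | Γ.InvClosed p.1 ∧ Γ.IsTotallyCyclic p.1 p.2}

/-- The order on `OP_Γ`: `(T',φ') ≤ (T,φ)` iff `T' ⊇ T` and `φ'` is the
restriction of `φ`. -/
def OPle (p q : Set Γ.E × Set Γ.E) : Prop :=
  q.1 ⊆ p.1 ∧ p.2 = q.2 ∩ p.1ᶜ

/-- `H₁(Γ,ℤ)` viewed as the set of lattice points of `H₁(Γ,ℝ)`. -/
def H1Z : Set (Γ.E → ℝ) := {c | Γ.IsCycle c ∧ ∀ e, ∃ n : ℤ, c e = (n : ℝ)}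

/-- The Voronoi polytope `Vor_Γ ⊆ H₁(Γ,ℝ)`. -/
def voronoi : Set (Γ.E → ℝ) :=
  {v | Γ.IsCycle v ∧ ∀ l ∈ Γ.H1Z, Γ.pair v v ≤ Γ.pair (v - l) (v - l)}

/-- A (exposed) face of the Voronoi polytope. -/
def IsVorFace (F : Set (Γ.E → ℝ)) : Prop :=
  ∃ l : (Γ.E → ℝ) →ₗ[ℝ] ℝ, F = {v | v ∈ Γ.voronoi ∧ ∀ w ∈ Γ.voronoi, l w ≤ l v}

/-- The face `F(T,φ)` of the Voronoi polytope associated to `(T,O) ∈ OP_Γ`. -/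
def vorFace (T O : Set Γ.E) : Set (Γ.E → ℝ) :=
  {v | v ∈ Γ.voronoi ∧ ∀ γ ∈ Γ.Cir T O,
      Γ.pair v (Γ.circChainR γ) = Γ.pair (Γ.circChainR γ) (Γ.circChainR γ) / 2}

end SerreGraph

namespace SerreGraph

variable {Γ : SerreGraph}

lemma t_inv (e : Γ.E) : Γ.t (Γ.inv e) = Γ.s e := by
  rw [← Γ.s_inv, Γ.inv_inv]

lemma pair_comm (c d : Γ.E → ℝ) : Γ.pair c d = Γ.pair d c := by
  simp only [pair, mul_comm]

lemma pair_add_smul_left (c d r : Γ.E → ℝ) (a : ℝ) :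
    Γ.pair (c + a • d) r = Γ.pair c r + a * Γ.pair d r := by
  simp only [pair, Pi.add_apply, Pi.smul_apply, smul_eq_mul, add_mul, Finset.sum_add_distrib,
    mul_assoc, ← Finset.mul_sum]
  ring

lemma IsCycle.add_smul {c d : Γ.E → ℝ} (hc : Γ.IsCycle c) (hd : Γ.IsCycle d) (a : ℝ) :
    Γ.IsCycle (c + a • d) := by
  refine ⟨fun e => ?_, fun v => ?_⟩
  · simp only [Pi.add_apply, Pi.smul_apply, smul_eq_mul, hc.1 e, hd.1 e]
    ring
  · simp only [Pi.add_apply, Pi.smul_apply, smul_eq_mul, Finset.sum_add_distrib,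
      ← Finset.mul_sum, hc.2 v, hd.2 v]
    ring

/-- The defining inequalities of the Voronoi polytope, in linear form. -/
lemma mem_voronoi_iff {v : Γ.E → ℝ} :
    v ∈ Γ.voronoi ↔ Γ.IsCycle v ∧ ∀ l ∈ Γ.H1Z, Γ.pair v l ≤ Γ.pair l l / 2 := by
  have key : ∀ l, Γ.pair (v - l) (v - l) = Γ.pair v v - 2 * Γ.pair v l + Γ.pair l l := by
    intro l
    have : ∀ e, (v - l) e * (v - l) e = v e * v e - 2 * (v e * l e) + l e * l e := by
      intro e
      simp only [Pi.sub_apply]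
      ring
    simp only [pair, this, Finset.sum_add_distrib, Finset.sum_sub_distrib, ← Finset.mul_sum]
    ring
  simp only [voronoi, Set.mem_ofPred_eq, key]
  refine and_congr_right fun _ => forall₂_congr fun l _ => ?_
  constructor <;> intro h <;> linarith

/-- The subspace `H₁(Γ,ℝ)` of cycles inside the Euclidean space of functions on oriented edges. -/
def cycleSubmodule (Γ : SerreGraph) : Submodule ℝ (EuclideanSpace ℝ Γ.E) where
  carrier := {c | Γ.IsCycle c.ofLp}
  zero_mem' := by simp [IsCycle]
  add_mem' {c d} hc hd := by
    have := IsCycle.add_smul hc hd 1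
    rwa [one_smul] at this
  smul_mem' a c hc := by
    have h0 : Γ.IsCycle (0 : Γ.E → ℝ) := by simp [IsCycle]
    have := IsCycle.add_smul h0 hc a
    rwa [zero_add] at this

/-- Orthogonal projection onto the cycle space. -/
lemma exists_cycle_pair_eq (x : Γ.E → ℝ) :
    ∃ r, Γ.IsCycle r ∧ ∀ l, Γ.IsCycle l → Γ.pair r l = Γ.pair x l := by
  let K := cycleSubmodule Γ
  let X : EuclideanSpace ℝ Γ.E := WithLp.toLp 2 x
  refine ⟨(K.starProjection X).ofLp, K.starProjection_apply_mem X, fun l hl => ?_⟩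
  have h := K.starProjection_inner_eq_zero X (WithLp.toLp 2 l) hl
  rw [inner_sub_left, sub_eq_zero] at h
  simp only [PiLp.inner_apply, RCLike.inner_apply, conj_trivial] at h
  simp only [pair]
  rw [Finset.sum_congr rfl fun e _ => mul_comm _ _, ← h,
    Finset.sum_congr rfl fun e _ => mul_comm _ _]

/-- The projection of a point of the cube lies in the Voronoi polytope. -/
lemma mem_voronoi_of_abs_le {x r : Γ.E → ℝ} (hx : ∀ e, |x e| ≤ 1 / 2) (hr : Γ.IsCycle r)
    (hrx : ∀ l, Γ.IsCycle l → Γ.pair r l = Γ.pair x l) : r ∈ Γ.voronoi := by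
  refine mem_voronoi_iff.2 ⟨hr, fun l hl => ?_⟩
  rw [hrx l hl.1]
  have : ∑ e, x e * l e ≤ (∑ e, l e * l e) / 2 := by
    rw [Finset.sum_div]
    refine Finset.sum_le_sum fun e _ => ?_
    obtain ⟨n, hn⟩ := hl.2 e
    have h1 : |l e| ≤ l e * l e := by
      rw [hn, ← Int.cast_abs]
      have : |n| ≤ n * n := by
        rw [← abs_mul_abs_self n]
        rcases eq_or_ne n 0 with rfl | h
        · simp
        · exact le_mul_of_one_le_left (abs_nonneg n) (Int.one_le_abs h)
      exact_mod_cast this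
    have h2 : x e * l e ≤ |x e| * |l e| := by
      rw [← abs_mul]
      exact le_abs_self _
    nlinarith [hx e, abs_nonneg (l e)]
  simp only [pair]
  linarith

lemma circChainR_of_mem {γ : Finset Γ.E} {e : Γ.E} (h : e ∈ γ) : Γ.circChainR γ e = 1 := by
  simp [circChainR, circChainZ, h]

lemma circChainR_of_inv_mem {γ : Finset Γ.E} (hγ : ∀ e ∈ γ, Γ.inv e ∉ γ) {e : Γ.E}
    (h : Γ.inv e ∈ γ) : Γ.circChainR γ e = -1 := by
  have : e ∉ γ := fun h' => hγ e h' h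
  simp [circChainR, circChainZ, h, this]

lemma circChainR_of_notMem {γ : Finset Γ.E} {e : Γ.E} (h : e ∉ γ) (h' : Γ.inv e ∉ γ) :
    Γ.circChainR γ e = 0 := by
  simp [circChainR, circChainZ, h, h']

lemma IsCircuit.card_eq {γ : Finset Γ.E} (hγ : Γ.IsCircuit γ) (v : Γ.V) :
    (γ.filter fun e => Γ.t e = v).card = (γ.filter fun e => Γ.s e = v).card := by
  by_cases hv : v ∈ γ.image Γ.s ∪ γ.image Γ.t
  · obtain ⟨e, he, he'⟩ := hγ.2.2.1 v hv
    obtain ⟨f, hf, hf'⟩ := hγ.2.2.2.1 v hv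
    have h1 : γ.filter (fun e => Γ.t e = v) = {f} := by
      ext a
      simp only [Finset.mem_filter, Finset.mem_singleton]
      exact ⟨hf' a, fun h => h ▸ hf⟩
    have h2 : γ.filter (fun e => Γ.s e = v) = {e} := by
      ext a
      simp only [Finset.mem_filter, Finset.mem_singleton]
      exact ⟨he' a, fun h => h ▸ he⟩
    rw [h1, h2, Finset.card_singleton, Finset.card_singleton]
  · simp only [Finset.mem_union, Finset.mem_image, not_or, not_exists, not_and] at hv
    rw [Finset.filter_false_of_mem hv.1, Finset.filter_false_of_mem hv.2]

lemma IsCircuit.isCycle {γ : Finset Γ.E} (hγ : Γ.IsCircuit γ) : Γ.IsCycle (Γ.circChainR γ) := by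
  have key : ∀ e, Γ.circChainR γ e =
      (if e ∈ γ then 1 else 0) - (if Γ.inv e ∈ γ then 1 else 0) := by
    intro e
    by_cases h : e ∈ γ
    · rw [circChainR_of_mem h, if_pos h, if_neg (hγ.2.1 e h), sub_zero]
    · by_cases h' : Γ.inv e ∈ γ
      · rw [circChainR_of_inv_mem hγ.2.1 h', if_neg h, if_pos h', zero_sub]
      · rw [circChainR_of_notMem h h', if_neg h, if_neg h', sub_zero]
  refine ⟨fun e => by rw [key, key, Γ.inv_inv, neg_sub], fun v => ?_⟩
  have hrev : ∑ e ∈ Finset.univ.filter (fun e => Γ.t e = v),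
        (if Γ.inv e ∈ γ then (1 : ℝ) else 0) =
      ∑ e ∈ Finset.univ.filter (fun e => Γ.s e = v), (if e ∈ γ then (1 : ℝ) else 0) := by
    refine Finset.sum_nbij' Γ.inv Γ.inv ?_ ?_ ?_ ?_ ?_ <;>
      simp [Γ.s_inv, t_inv, Γ.inv_inv]
  have hcard : ∀ p : Γ.E → Prop, ∀ [DecidablePred p],
      ∑ e ∈ Finset.univ.filter p, (if e ∈ γ then (1 : ℝ) else 0) = (γ.filter p).card := by
    intro p _
    rw [← Finset.sum_filter, Finset.sum_const, nsmul_eq_mul, mul_one]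
    congr 2
    ext e
    simp [and_comm]
  simp only [key, Finset.sum_sub_distrib]
  rw [hrev, hcard, hcard, hγ.card_eq, sub_self]

lemma IsCircuit.mem_H1Z {γ : Finset Γ.E} (hγ : Γ.IsCircuit γ) : Γ.circChainR γ ∈ Γ.H1Z :=
  ⟨hγ.isCycle, fun e => ⟨Γ.circChainZ γ e, rfl⟩⟩

/-- A cycle that is positive on an edge arriving at `v` is positive on an edge leaving `v`. -/
lemma IsCycle.exists_pos_of_pos {α : Γ.E → ℝ} (hα : Γ.IsCycle α) {e : Γ.E} (he : 0 < α e) :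
    ∃ f, 0 < α f ∧ Γ.s f = Γ.t e := by
  by_contra! h
  have hpos : 0 < ∑ f ∈ Finset.univ.filter (fun f => Γ.t f = Γ.t e), α f := by
    refine Finset.sum_pos' (fun f hf => ?_) ⟨e, by simp, he⟩
    by_contra! hneg
    refine h (Γ.inv f) ?_ ?_
    · rw [hα.1]
      linarith
    · rw [Γ.s_inv]
      exact (Finset.mem_filter.1 hf).2
  exact hpos.ne' (hα.2 _)

/-- The positive support of a cycle which is not identically zero contains an oriented circuit. -/
lemma IsCycle.exists_isCircuit {α : Γ.E → ℝ} (hα : Γ.IsCycle α) (hne : ∃ e, 0 < α e) :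
    ∃ γ, Γ.IsCircuit γ ∧ ∀ e ∈ γ, 0 < α e := by
  obtain ⟨e₀, he₀⟩ := hne
  have : Nonempty Γ.E := ⟨e₀⟩
  have hout : ∀ v, (∃ e, 0 < α e ∧ Γ.s e = v) → ∃ e, 0 < α e ∧ Γ.s e = v := fun _ h => h
  choose! g hgpos hgs using hout
  let f : Γ.V → Γ.V := fun v => Γ.t (g v)
  have hiter : ∀ n, ∃ e, 0 < α e ∧ Γ.s e = f^[n] (Γ.s e₀) := by
    intro n
    induction n with
    | zero => exact ⟨e₀, he₀, rfl⟩
    | succ n ih =>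
      rw [Function.iterate_succ_apply']
      exact hα.exists_pos_of_pos (hgpos _ ih)
  obtain ⟨m, n, hmn, hlt⟩ : ∃ m n, f^[m] (Γ.s e₀) = f^[n] (Γ.s e₀) ∧ m < n := by
    obtain ⟨m, n, hne, heq⟩ :=
      Finite.exists_ne_map_eq_of_infinite (fun k : ℕ => f^[k] (Γ.s e₀))
    rcases lt_or_gt_of_ne hne with h | h
    · exact ⟨m, n, heq, h⟩
    · exact ⟨n, m, heq.symm, h⟩
  let v₀ := f^[m] (Γ.s e₀)
  obtain ⟨k, hk⟩ : ∃ k, f^[k + 1] v₀ = v₀ := by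
    refine ⟨n - m - 1, ?_⟩
    rw [← Function.iterate_add_apply, show n - m - 1 + 1 + m = n by omega]
    exact hmn.symm
  let orbit : Set Γ.V := {w | ∃ n, f^[n] v₀ = w}
  have hsupp : ∀ w ∈ orbit, ∃ e, 0 < α e ∧ Γ.s e = w := by
    rintro w ⟨n, rfl⟩
    rw [← Function.iterate_add_apply]
    exact hiter _
  have hstep : ∀ w ∈ orbit, f w ∈ orbit := by
    rintro w ⟨n, rfl⟩
    exact ⟨n + 1, Function.iterate_succ_apply' f n v₀⟩
  have hback : ∀ w ∈ orbit, f^[k] (f w) = w := by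
    rintro w ⟨n, rfl⟩
    rw [← Function.iterate_succ_apply, ← Function.iterate_add_apply, add_comm,
      Function.iterate_add_apply, hk]
  have horbit_iter : ∀ j, ∀ w ∈ orbit, f^[j] w ∈ orbit := by
    rintro j w ⟨n, rfl⟩
    exact ⟨j + n, Function.iterate_add_apply f j n v₀⟩
  have hsurj : ∀ w ∈ orbit, ∃ u ∈ orbit, f u = w := by
    intro w hw
    refine ⟨f^[k] w, horbit_iter k w hw, ?_⟩
    rw [← Function.iterate_succ_apply' f k, Function.iterate_succ_apply]
    exact hback w hw
  classical
  let γ : Finset Γ.E := (Finset.univ.filter (· ∈ orbit)).image g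
  have hmem : ∀ e, e ∈ γ ↔ ∃ w ∈ orbit, g w = e := by simp [γ]
  have hpos : ∀ e ∈ γ, 0 < α e := by
    intro e he
    obtain ⟨w, hw, rfl⟩ := (hmem e).1 he
    exact hgpos w (hsupp w hw)
  have hs : ∀ w ∈ orbit, Γ.s (g w) = w := fun w hw => hgs w (hsupp w hw)
  have hvert : ∀ v ∈ γ.image Γ.s ∪ γ.image Γ.t, v ∈ orbit := by
    intro v hv
    simp only [Finset.mem_union, Finset.mem_image, hmem] at hv
    rcases hv with ⟨_, ⟨w, hw, rfl⟩, rfl⟩ | ⟨_, ⟨w, hw, rfl⟩, rfl⟩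
    · rwa [hs w hw]
    · exact hstep w hw
  have hreach : ∀ j, ∀ w ∈ orbit, Γ.Reach ((↑γ : Set Γ.E) ∪ Γ.inv '' ↑γ) w (f^[j] w) := by
    intro j w hw
    induction j with
    | zero => exact Relation.ReflTransGen.refl
    | succ j ih =>
      rw [Function.iterate_succ_apply']
      have hj := horbit_iter j w hw
      exact ih.tail ⟨g (f^[j] w), Or.inl ((hmem _).2 ⟨_, hj, rfl⟩), hs _ hj, rfl⟩
  have hreach₀ : ∀ w ∈ orbit, ∃ j, f^[j] w = v₀ := by
    rintro w ⟨n, rfl⟩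
    induction n with
    | zero => exact ⟨0, rfl⟩
    | succ n ih =>
      obtain ⟨j, hj⟩ := ih
      refine ⟨j + k, ?_⟩
      rw [Function.iterate_succ_apply', Function.iterate_add_apply, hback _ ⟨n, rfl⟩, hj]
  refine ⟨γ, ⟨⟨g v₀, (hmem _).2 ⟨v₀, ⟨0, rfl⟩, rfl⟩⟩, ?_, ?_, ?_, ?_⟩, hpos⟩
  · intro e he he'
    have h1 := hpos e he
    have h2 := hpos _ he'
    rw [hα.1] at h2
    linarith
  · intro v hv
    have hv' := hvert v hv
    refine ⟨g v, ⟨(hmem _).2 ⟨v, hv', rfl⟩, hs v hv'⟩, ?_⟩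
    rintro e ⟨he, hev⟩
    obtain ⟨w, hw, rfl⟩ := (hmem e).1 he
    rw [← hev, hs w hw]
  · intro v hv
    obtain ⟨u, hu, huv⟩ := hsurj v (hvert v hv)
    refine ⟨g u, ⟨(hmem _).2 ⟨u, hu, rfl⟩, huv⟩, ?_⟩
    rintro e ⟨he, hev⟩
    obtain ⟨w, hw, rfl⟩ := (hmem e).1 he
    have hfw : f w = f u := hev.trans huv.symm
    rw [← hback w hw, hfw, hback u hu]
  · intro e he e' he'
    obtain ⟨w, hw, rfl⟩ := (hmem e).1 he
    obtain ⟨w', hw', rfl⟩ := (hmem e').1 he'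
    rw [hs w hw, hs w' hw']
    obtain ⟨j, hj⟩ := hreach₀ w hw
    obtain ⟨n, rfl⟩ := hw'
    have h1 := hreach j w hw
    rw [hj] at h1
    exact h1.trans (hreach n v₀ ⟨0, rfl⟩)

/-- Elements of `σ(T,φ)` are positive only on edges that are positively oriented. -/
lemma mem_of_sigmaCone_pos {T O : Set Γ.E} (hO : Γ.IsOrientation T O) {α : Γ.E → ℝ}
    (hα : α ∈ Γ.sigmaCone T O) {e : Γ.E} (he : 0 < α e) : e ∈ O := by
  have heT : e ∉ T := fun h => he.ne' (hα.2.2 e h)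
  refine (hO.2 e heT).2 fun h => ?_
  have := hα.2.1 _ h
  rw [hα.1.1] at this
  linarith

/-- Elements of `σ(T,φ)` are maximised over the Voronoi polytope on `F(T,φ)`; the proof
successively subtracts oriented circuits. -/
lemma pair_le_of_mem_sigmaCone {T O : Set Γ.E} (hO : Γ.IsOrientation T O) {r r' : Γ.E → ℝ}
    (hr : r ∈ Γ.vorFace T O) (hr' : r' ∈ Γ.voronoi) {α : Γ.E → ℝ} (hα : α ∈ Γ.sigmaCone T O) :
    Γ.pair α r' ≤ Γ.pair α r := by
  induction hN : (Finset.univ.filter fun e => 0 < α e).card using Nat.strong_induction_on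
    generalizing α with
  | _ N ih =>
  by_cases hne : ∃ e, 0 < α e
  · obtain ⟨γ, hγ, hpos⟩ := hα.1.exists_isCircuit hne
    have hγO : ∀ e ∈ γ, e ∈ O := fun e he => mem_of_sigmaCone_pos hO hα (hpos e he)
    have hγT : ∀ e ∈ γ, e ∉ T := fun e he => hO.1 e (hγO e he)
    obtain ⟨e₀, he₀, hmin⟩ := γ.exists_min_image α hγ.1
    let β := α + (-α e₀) • Γ.circChainR γ
    have hc : 0 < α e₀ := hpos e₀ he₀
    have hβ : β ∈ Γ.sigmaCone T O := by
      refine ⟨hα.1.add_smul hγ.isCycle _, fun e he => ?_, fun e he => ?_⟩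
      · simp only [β, Pi.add_apply, Pi.smul_apply, smul_eq_mul]
        by_cases h : e ∈ γ
        · rw [circChainR_of_mem h]
          linarith [hmin e h]
        · have h' : Γ.inv e ∉ γ := fun h' => (hO.2 e (hO.1 e he)).1 he (hγO _ h')
          rw [circChainR_of_notMem h h']
          linarith [hα.2.1 e he]
      · have h : e ∉ γ := fun h => hγT e h he
        have h' : Γ.inv e ∉ γ := by
          intro h'
          have := hpos _ h'
          rw [hα.1.1, hα.2.2 e he] at this
          simp at this
        simp only [β, Pi.add_apply, Pi.smul_apply, smul_eq_mul]
        rw [circChainR_of_notMem h h', hα.2.2 e he]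
        ring
    have hlt : (Finset.univ.filter fun e => 0 < β e).card < N := by
      rw [← hN]
      refine Finset.card_lt_card ((Finset.ssubset_iff_of_subset fun e he => ?_).2 ⟨e₀, ?_, ?_⟩)
      · simp only [Finset.mem_filter, Finset.mem_univ, true_and, β, Pi.add_apply, Pi.smul_apply,
          smul_eq_mul] at he ⊢
        by_cases h : e ∈ γ
        · exact hpos e h
        · by_cases h' : Γ.inv e ∈ γ
          · have := hmin _ h'
            rw [circChainR_of_inv_mem hγ.2.1 h'] at he
            rw [hα.1.1] at this
            linarith
          · rw [circChainR_of_notMem h h'] at he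
            linarith
      · simpa using hc
      · simp [β, circChainR_of_mem he₀]
    have hβle := ih _ hlt hβ rfl
    rw [pair_add_smul_left, pair_add_smul_left] at hβle
    have h1 := hr.2 γ ⟨hγ, hγO, hγT⟩
    have h2 := (mem_voronoi_iff.1 hr').2 _ hγ.mem_H1Z
    rw [pair_comm, ← h1, pair_comm r] at h2
    nlinarith
  · push Not at hne
    have h0 : ∀ e, α e = 0 := by
      intro e
      have := hne (Γ.inv e)
      rw [hα.1.1] at this
      linarith [hne e]
    simp [pair, h0]

open Classical in
/-- The chain equal to `1/2` on positively oriented edges and `0` on `T`. -/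
noncomputable def halfChain (O : Set Γ.E) : Γ.E → ℝ :=
  fun e => if e ∈ O then 1 / 2 else if Γ.inv e ∈ O then -(1 / 2) else 0

lemma abs_halfChain_le (O : Set Γ.E) (e : Γ.E) : |halfChain O e| ≤ 1 / 2 := by
  unfold halfChain
  split_ifs <;> norm_num [abs_of_pos]

lemma mem_vorFace_of_halfChain {T O : Set Γ.E} (hO : Γ.IsOrientation T O) {r : Γ.E → ℝ}
    (hr : Γ.IsCycle r) (hrx : ∀ l, Γ.IsCycle l → Γ.pair r l = Γ.pair (halfChain O) l) :
    r ∈ Γ.vorFace T O := by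
  refine ⟨mem_voronoi_of_abs_le (abs_halfChain_le O) hr hrx, fun γ hγ => ?_⟩
  rw [hrx _ hγ.1.isCycle, pair, pair]
  congr 1
  rw [Finset.sum_div]
  refine Finset.sum_congr rfl fun e _ => ?_
  by_cases h : e ∈ γ
  · rw [circChainR_of_mem h, halfChain, if_pos (hγ.2.1 e h)]
    ring
  · by_cases h' : Γ.inv e ∈ γ
    · have hi := hγ.2.1 _ h'
      have he : e ∉ O := fun he => (hO.2 e (hO.1 e he)).1 he hi
      rw [circChainR_of_inv_mem hγ.1.2.1 h', halfChain, if_neg he, if_pos hi]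
      ring
    · rw [circChainR_of_notMem h h']
      ring

lemma pair_update (α x : Γ.E → ℝ) (e : Γ.E) (a : ℝ) :
    Γ.pair α (Function.update x e a) = Γ.pair α x + α e * (a - x e) / 2 := by
  have h : ∀ y : Γ.E → ℝ, ∑ f, α f * y f =
      α e * y e + ∑ f ∈ Finset.univ.erase e, α f * y f := fun y =>
    (Finset.add_sum_erase _ _ (Finset.mem_univ e)).symm
  have h' : ∑ f ∈ Finset.univ.erase e, α f * Function.update x e a f =
      ∑ f ∈ Finset.univ.erase e, α f * x f :=
    Finset.sum_congr rfl fun f hf => by rw [Function.update_of_ne (Finset.ne_of_mem_erase hf)]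
  rw [pair, pair, h, h x, h', Function.update_self]
  ring

/-- Moving one coordinate of the cube vertex `halfChain O` cannot increase the pairing with an
element of the normal cone. -/
lemma normalCone_coord {T O : Set Γ.E} (hO : Γ.IsOrientation T O) {α : Γ.E → ℝ}
    (hα : Γ.IsCycle α)
    (hmax : ∀ r ∈ Γ.vorFace T O, ∀ r' ∈ Γ.voronoi, Γ.pair α r' ≤ Γ.pair α r)
    (e : Γ.E) {a : ℝ} (ha : |a| ≤ 1 / 2) : α e * (a - halfChain O e) ≤ 0 := by
  obtain ⟨r, hr, hrx⟩ := exists_cycle_pair_eq (halfChain O)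
  obtain ⟨r', hr', hrx'⟩ := exists_cycle_pair_eq (Function.update (halfChain O) e a)
  have hbound : ∀ f, |Function.update (halfChain O) e a f| ≤ 1 / 2 := by
    intro f
    rcases eq_or_ne f e with rfl | h
    · rwa [Function.update_self]
    · rw [Function.update_of_ne h]
      exact abs_halfChain_le O f
  have h := hmax r (mem_vorFace_of_halfChain hO hr hrx) r' (mem_voronoi_of_abs_le hbound hr' hrx')
  rw [pair_comm α, pair_comm α, hrx α hα, hrx' α hα, pair_comm _ α, pair_comm _ α,
    pair_update] at h
  linarith

end SerreGraph

/-- For `(T,φ) ∈ OP_Γ`, the normal cone to the face `F(T,φ)`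
of the Voronoi polytope equals `σ(T,φ)`; hence the cographic fan is the normal
fan of `Vor_Γ`. -/
theorem stmt15 (Γ : SerreGraph) (p : Set Γ.E × Set Γ.E) (hp : p ∈ Γ.OP) :
    {α : Γ.E → ℝ | Γ.IsCycle α ∧ ∀ r ∈ Γ.vorFace p.1 p.2, ∀ r' ∈ Γ.voronoi,
        Γ.pair α r' ≤ Γ.pair α r} = Γ.sigmaCone p.1 p.2 := by
  obtain ⟨hT, hO, -⟩ := hp
  ext α
  constructor
  · rintro ⟨hα, hmax⟩
    refine ⟨hα, fun e he => ?_, fun e he => ?_⟩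
    · have h := SerreGraph.normalCone_coord hO hα hmax e (a := 0) (by norm_num)
      rw [SerreGraph.halfChain, if_pos he] at h
      linarith
    · have h0 : SerreGraph.halfChain p.2 e = 0 := by
        rw [SerreGraph.halfChain, if_neg fun h => hO.1 _ h he,
          if_neg fun h => hO.1 _ h ((hT e).1 he)]
      have h1 := SerreGraph.normalCone_coord hO hα hmax e (a := 1 / 2) (by norm_num [abs_of_pos])
      have h2 := SerreGraph.normalCone_coord hO hα hmax e (a := -(1 / 2))
        (by norm_num [abs_of_pos])
      rw [h0] at h1 h2
      linarith
  · intro hα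
    exact ⟨hα.1, fun r hr r' hr' => SerreGraph.pair_le_of_mem_sigmaCone hO hr hr' hα⟩
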